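/- Let V be a finite-dimensional real vector space, p ≥ 1, let O ⊆ ℝ^p be an open dense subset, and let k : ℝ^p → End(V) be a map whose restriction to O is C^∞ and such that k(ξ) is invertible (k(ξ) ∈ GL(V)) for every ξ ∈ O. Let (a_I)_{I} be a family of maps ℝ^p → End(V), indexed by multi-indices I ∈ ℕ^p with only finitely many a_I nonzero, such that each a_I is a polynomial map (each matrix entry of a_I with respect to a fixed basis of V is a polynomial function on ℝ^p). Assume that for every C^∞ compactly supported function ψ : ℝ^p → V with supp(ψ) ⊆ O, the function ξ ↦ k(ξ)ψ(ξ), extended by 0 outside O (which is C^∞ on ℝ^p), satisfies ∑_I a_I(ξ)·(∂^I (kψ))(ξ) = 0 for all ξ ∈ ℝ^p. Then a_I = 0 identically for every multi-index I. -/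

import Mathlib

/-- Partial derivative along the j-th coordinate direction, for V-valued functions on ℝ^p. -/
noncomputable def pderivAlong {p : ℕ} {W : Type} [NormedAddCommGroup W] [NormedSpace ℝ W]
    (j : Fin p) (f : EuclideanSpace ℝ (Fin p) → W) : EuclideanSpace ℝ (Fin p) → W :=
  fun ξ => fderiv ℝ f ξ (EuclideanSpace.single j 1)

/-- Iterated partial derivative ∂^I = ∂^{i₁}_{ξ₁}⋯∂^{i_p}_{ξ_p} for a multi-index I ∈ ℕ^p. -/
noncomputable def pderivMulti {p : ℕ} {W : Type} [NormedAddCommGroup W] [NormedSpace ℝ W]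
    (I : Fin p → ℕ) (f : EuclideanSpace ℝ (Fin p) → W) : EuclideanSpace ℝ (Fin p) → W :=
  (List.ofFn fun j : Fin p => (pderivAlong j)^[I j]).foldr (· ∘ ·) id f


lemma foldr_comp_eventuallyEq {E W : Type*} [TopologicalSpace E] (x : E)
    (l : List ((E → W) → (E → W)))
    (hl : ∀ D ∈ l, ∀ f g : E → W, f =ᶠ[nhds x] g → D f =ᶠ[nhds x] D g)
    (f g : E → W) (h : f =ᶠ[nhds x] g) :
    l.foldr (· ∘ ·) id f =ᶠ[nhds x] l.foldr (· ∘ ·) id g := by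
  induction l with
  | nil => simpa using h
  | cons D l ih =>
    simp only [List.foldr_cons, Function.comp_apply]
    exact hl D (by simp) _ _ (ih fun D' hD' => hl D' (by simp [hD']))

lemma pderivMulti_congr {p : ℕ} {W : Type} [NormedAddCommGroup W] [NormedSpace ℝ W]
    (I : Fin p → ℕ) (x : EuclideanSpace ℝ (Fin p)) (f g : EuclideanSpace ℝ (Fin p) → W)
    (h : f =ᶠ[nhds x] g) : pderivMulti I f =ᶠ[nhds x] pderivMulti I g := by
  unfold pderivMulti
  refine foldr_comp_eventuallyEq x _ ?_ f g h
  intro D hD f g hfg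
  obtain ⟨j, rfl⟩ := (List.mem_ofFn' _ _).1 hD
  dsimp only
  generalize I j = n
  induction n with
  | zero => simpa using hfg
  | succ n ih =>
    rw [Function.iterate_succ_apply', Function.iterate_succ_apply']
    filter_upwards [ih.fderiv (𝕜 := ℝ)] with y hy
    simp only [pderivAlong, hy]

/-- The exponential `exp (∑ t_j ξ_j) • v`. -/
noncomputable def expVec {p : ℕ} {W : Type} [NormedAddCommGroup W] [NormedSpace ℝ W]
    (t : Fin p → ℝ) (v : W) : EuclideanSpace ℝ (Fin p) → W :=
  fun ξ => Real.exp (∑ j, t j * ξ j) • v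

lemma pderivAlong_expVec {p : ℕ} {W : Type} [NormedAddCommGroup W] [NormedSpace ℝ W]
    (j : Fin p) (t : Fin p → ℝ) (v : W) :
    pderivAlong j (expVec t v) = expVec t (t j • v) := by
  funext ξ
  let L : EuclideanSpace ℝ (Fin p) →L[ℝ] ℝ := ∑ j, t j • EuclideanSpace.proj j
  have hL : ∀ ξ, L ξ = ∑ j, t j * ξ j := by intro ξ; simp [L]
  have h : HasFDerivAt (fun ξ => Real.exp (L ξ) • v) _ ξ := (L.hasFDerivAt.exp).smul_const v
  have e : (expVec t v) = fun ξ => Real.exp (L ξ) • v := by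
    funext ξ; simp only [expVec, hL]
  simp only [pderivAlong]
  rw [e, h.fderiv]
  simp [expVec, hL, smul_smul, PiLp.single_apply]

lemma iterate_pderivAlong_expVec {p : ℕ} {W : Type} [NormedAddCommGroup W] [NormedSpace ℝ W]
    (j : Fin p) (t : Fin p → ℝ) (n : ℕ) (v : W) :
    (pderivAlong j)^[n] (expVec t v) = expVec t (t j ^ n • v) := by
  induction n with
  | zero => simp
  | succ n ih =>
    rw [Function.iterate_succ_apply', ih, pderivAlong_expVec, smul_smul, pow_succ']

lemma foldr_expVec {p : ℕ} {W : Type} [NormedAddCommGroup W] [NormedSpace ℝ W]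
    (I : Fin p → ℕ) (t : Fin p → ℝ) (v : W) (l : List (Fin p)) :
    (l.map fun j : Fin p => (pderivAlong j)^[I j]).foldr (· ∘ ·) id (expVec t v)
      = expVec t ((l.map fun j => t j ^ I j).prod • v) := by
  induction l with
  | nil => simp
  | cons j l ih =>
    simp only [List.map_cons, List.foldr_cons, Function.comp_apply, List.prod_cons]
    rw [ih, iterate_pderivAlong_expVec, smul_smul]

lemma pderivMulti_expVec {p : ℕ} {W : Type} [NormedAddCommGroup W] [NormedSpace ℝ W]
    (I : Fin p → ℕ) (t : Fin p → ℝ) (v : W) :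
    pderivMulti I (expVec t v) = expVec t ((∏ j, t j ^ I j) • v) := by
  unfold pderivMulti
  rw [List.ofFn_eq_map, foldr_expVec, ← List.ofFn_eq_map, List.prod_ofFn]

lemma coeffs_zero {p : ℕ} (S : Finset (Fin p → ℕ)) (c : (Fin p → ℕ) → ℝ)
    (h : ∀ t : Fin p → ℝ, ∑ I ∈ S, c I * ∏ j, t j ^ I j = 0) : ∀ I ∈ S, c I = 0 := by
  classical
  intro J hJ
  let P : MvPolynomial (Fin p) ℝ :=
    ∑ I ∈ S, MvPolynomial.monomial (Finsupp.equivFunOnFinite.symm I) (c I)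
  have hP : P = 0 := by
    apply MvPolynomial.funext
    intro t
    rw [map_zero, ← h t]
    simp only [P, map_sum, MvPolynomial.eval_monomial]
    refine Finset.sum_congr rfl fun I _ => ?_
    rw [Finsupp.prod_fintype _ _ (by simp)]
    rfl
  have := congrArg (MvPolynomial.coeff (Finsupp.equivFunOnFinite.symm J)) hP
  simpa [P, MvPolynomial.coeff_sum, MvPolynomial.coeff_monomial, hJ] using this

/-- If a polynomial-coefficient differential operator annihilates k·ψ for all smooth ψ
compactly supported in O (where k is smooth and invertible on the open dense set O),
then the operator is zero. -/
theorem poly_diff_op_vanishes (p : ℕ) (hp : 1 ≤ p)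
    (V : Type) [NormedAddCommGroup V] [NormedSpace ℝ V] [FiniteDimensional ℝ V]
    (O : Set (EuclideanSpace ℝ (Fin p))) (hOopen : IsOpen O) (hOdense : Dense O)
    (k : EuclideanSpace ℝ (Fin p) → (V →L[ℝ] V))
    (hk : ContDiffOn ℝ (⊤ : ℕ∞) k O)
    (hkinv : ∀ ξ ∈ O, IsUnit (k ξ))
    (a : (Fin p → ℕ) → EuclideanSpace ℝ (Fin p) → (V →L[ℝ] V))
    (hfin : {I | a I ≠ 0}.Finite)
    (hpoly : ∀ I, ∃ (m : ℕ) (q : Fin m → MvPolynomial (Fin p) ℝ) (T : Fin m → (V →L[ℝ] V)),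
      ∀ ξ, a I ξ = ∑ i : Fin m, MvPolynomial.eval (fun j => ξ j) (q i) • T i)
    (hzero : ∀ ψ : EuclideanSpace ℝ (Fin p) → V, ContDiff ℝ (⊤ : ℕ∞) ψ → HasCompactSupport ψ →
      tsupport ψ ⊆ O →
      ∀ ξ, (∑ᶠ I : Fin p → ℕ,
        a I ξ (pderivMulti I (Set.indicator O fun ζ => k ζ (ψ ζ)) ξ)) = 0) :
    ∀ I, a I = 0 := by
  classical
  have key : ∀ x ∈ O, ∀ (t : Fin p → ℝ) (v : V),
      ∑ I ∈ hfin.toFinset, (∏ j, t j ^ I j) • a I x v = 0 := by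
    intro x hx t v
    obtain ⟨r, hr, hrO⟩ := Metric.nhds_basis_closedBall.mem_iff.1 (hOopen.mem_nhds hx)
    let η : ContDiffBump x := ⟨r / 2, r, by positivity, by linarith⟩
    let ψ : EuclideanSpace ℝ (Fin p) → V :=
      fun ζ => η ζ • Ring.inverse (k ζ) (expVec t v ζ)
    have hsub : tsupport ψ ⊆ tsupport η :=
      closure_mono (Function.support_smul_subset_left _ _)
    have hηO : tsupport η ⊆ O := by rw [η.tsupport_eq]; exact hrO
    have hexp : ContDiff ℝ (⊤ : ℕ∞) (expVec (p := p) t v) := by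
      unfold expVec
      fun_prop
    have hψ : ContDiff ℝ (⊤ : ℕ∞) ψ := by
      rw [contDiff_iff_contDiffAt]
      intro y
      by_cases hy : y ∈ tsupport ψ
      swap
      · exact (contDiffAt_const (c := (0 : V))).congr_of_eventuallyEq
          (notMem_tsupport_iff_eventuallyEq.1 hy)
      have hyO := hηO (hsub hy)
      have hky : ContDiffAt ℝ (⊤ : ℕ∞) k y := hk.contDiffAt (hOopen.mem_nhds hyO)
      obtain ⟨u, hu⟩ := hkinv y hyO
      have hinv : ContDiffAt ℝ (⊤ : ℕ∞) (fun ζ => Ring.inverse (k ζ)) y := by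
        have h1 := contDiffAt_ringInverse (n := ((⊤ : ℕ∞) : WithTop ℕ∞)) ℝ u
        rw [hu] at h1
        exact h1.comp y hky
      exact η.contDiff.contDiffAt.smul (hinv.clm_apply hexp.contDiffAt)
    have hcs : HasCompactSupport ψ :=
      η.hasCompactSupport.of_isClosed_subset (isClosed_tsupport _) hsub
    have h0 := hzero ψ hψ hcs (hsub.trans hηO) x
    have hev : (Set.indicator O fun ζ => k ζ (ψ ζ)) =ᶠ[nhds x] expVec t v := by
      filter_upwards [hOopen.mem_nhds hx, η.eventuallyEq_one] with y hy hy1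
      rw [Set.indicator_of_mem hy]
      simp only [ψ, hy1, Pi.one_apply, one_smul]
      rw [← mul_apply_eq_comp, Ring.mul_inverse_cancel _ (hkinv y hy)]
      rfl
    have hterm : ∀ I, pderivMulti I (Set.indicator O fun ζ => k ζ (ψ ζ)) x
        = Real.exp (∑ j, t j * x j) • (∏ j, t j ^ I j) • v := by
      intro I
      rw [(pderivMulti_congr I x _ _ hev).eq_of_nhds, pderivMulti_expVec]
      rfl
    simp only [hterm] at h0
    rw [finsum_eq_sum_of_support_subset (s := hfin.toFinset)] at h0
    · simp only [map_smul] at h0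
      rw [← Finset.smul_sum] at h0
      exact (smul_eq_zero.1 h0).resolve_left (Real.exp_ne_zero _)
    · intro I hI
      simp only [Set.Finite.coe_toFinset, Set.mem_setOf_eq]
      intro h
      simp [h] at hI
  have hO : ∀ I, ∀ x ∈ O, a I x = 0 := by
    intro I x hx
    by_cases hI : a I = 0
    · simp [hI]
    ext v
    apply (Module.forall_dual_apply_eq_zero_iff ℝ (a I x v)).1
    intro L
    refine coeffs_zero hfin.toFinset (fun I => L (a I x v)) ?_ I (by simpa using hI)
    intro t
    have := congrArg L (key x hx t v)
    simpa [mul_comm] using this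
  intro I
  have hc : Continuous (a I) := by
    obtain ⟨m, q, T, h⟩ := hpoly I
    rw [funext h]
    refine continuous_finsetSum _ fun i _ => Continuous.fun_smul ?_ continuous_const
    exact (MvPolynomial.continuous_eval (q i)).comp (by fun_prop)
  exact hc.ext_on hOdense continuous_const (fun x hx => hO I x hx)
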